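/- Assume γ_i > 0 for every i = 1,…,m. Then for every p > 1 there exists δ ∈ (0,1] and positive constants c₀ and c₁ (depending only on δ, p, and the parameters m, β, μ_i, γ_i) such that ⟨b(x,u), ∇V_p(x)⟩ ≤ c₀ - c₁ V_p(x) for all x ∈ ℝ^m and all u ∈ Δ. -/

import Mathlib

open scoped BigOperators

noncomputable section

/-- The piecewise function `ψ` from Definition 1 of the paper. -/
def psi (t : ℝ) : ℝ :=
  if t ≤ -1 then -(1/2)
  else if t ≤ 0 then (t+1)^3 - (1/2)*(t+1)^4 - 1/2
  else t

/-- `Ψ(x) = ∑ i, ψ(x_i)/μ_i`. -/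
def Psi (m : ℕ) (μ : Fin m → ℝ) (x : Fin m → ℝ) : ℝ := ∑ i, psi (x i) / μ i

/-- The Lyapunov function `V_p(x) = (δ Ψ(-x) + Ψ(x) + m / min_i μ_i)^p`. -/
def Vp (m : ℕ) (μ : Fin m → ℝ) (δ p : ℝ) (x : Fin m → ℝ) : ℝ :=
  (δ * Psi m μ (-x) + Psi m μ x + (m : ℝ) / ⨅ i, μ i) ^ p

/-- The drift `b(x,u) = -(β/m) M e - M (x - ⟨e,x⟩⁺ u) - ⟨e,x⟩⁺ Γ u`, written
componentwise, where `M = diag(μ)` and `Γ = diag(γ)`. -/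
def drift (m : ℕ) (μ γ : Fin m → ℝ) (β : ℝ) (x u : Fin m → ℝ) : Fin m → ℝ :=
  fun i => -(β / (m : ℝ)) * μ i - μ i * (x i - max (∑ j, x j) 0 * u i)
    - max (∑ j, x j) 0 * (γ i * u i)

/-- Gluing derivatives of a piecewise function. -/
lemma glue_hasDerivAt (a : ℝ) (g h g' h' : ℝ → ℝ) (hg : ∀ t, HasDerivAt g (g' t) t)
    (hh : ∀ t, HasDerivAt h (h' t) t) (e : g a = h a) (e' : g' a = h' a) (t : ℝ) :
    HasDerivAt (fun t => if t ≤ a then g t else h t) (if t ≤ a then g' t else h' t) t := by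
  rcases lt_trichotomy t a with ht | ht | ht
  · rw [if_pos ht.le]
    refine (hg t).congr_of_eventuallyEq ?_
    filter_upwards [Iio_mem_nhds ht] with s hs
    rw [if_pos (le_of_lt hs)]
  · subst ht
    rw [if_pos le_rfl]
    have h1 : HasDerivWithinAt (fun s => if s ≤ t then g s else h s) (g' t) (Set.Iic t) t :=
      (hg t).hasDerivWithinAt.congr (fun s hs => if_pos hs) (if_pos le_rfl)
    have h2 : HasDerivWithinAt (fun s => if s ≤ t then g s else h s) (g' t) (Set.Ici t) t := by
      rw [e']
      refine (hh t).hasDerivWithinAt.congr (fun s hs => ?_) ?_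
      · rcases eq_or_lt_of_le (Set.mem_Ici.mp hs) with h0 | h0
        · subst h0; simp [e]
        · rw [if_neg (not_le.mpr h0)]
      · simp [e]
    have h3 := h1.union h2
    rw [Set.Iic_union_Ici] at h3
    exact hasDerivWithinAt_univ.mp h3
  · rw [if_neg (not_le.mpr ht)]
    refine (hh t).congr_of_eventuallyEq ?_
    filter_upwards [Ioi_mem_nhds ht] with s hs
    rw [if_neg (not_le.mpr hs)]

def dpsi (t : ℝ) : ℝ :=
  if t ≤ -1 then 0 else if t ≤ 0 then 3 * (t+1)^2 - 2 * (t+1)^3 else 1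

lemma psi_hasDerivAt (t : ℝ) : HasDerivAt psi (dpsi t) t := by
  have hq : ∀ t : ℝ, HasDerivAt (fun t : ℝ => (t+1)^3 - (1/2)*(t+1)^4 - 1/2)
      (3 * (t+1)^2 - 2 * (t+1)^3) t := by
    intro t
    have h1 : HasDerivAt (fun t : ℝ => t + 1) 1 t := (hasDerivAt_id t).add_const 1
    have h2 := (((h1.pow 3).sub ((h1.pow 4).const_mul (1/2))).sub_const (1/2))
    refine h2.congr_deriv ?_
    norm_num
    ring
  have h1 := glue_hasDerivAt 0 _ (fun t => t) _ (fun _ => 1) hq (fun t => hasDerivAt_id t)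
    (by norm_num) (by norm_num)
  exact glue_hasDerivAt (-1) (fun _ => -(1/2)) _ (fun _ => 0) _
    (fun t => hasDerivAt_const t _) h1 (by norm_num) (by norm_num) t

lemma dpsi_nonneg (t : ℝ) : 0 ≤ dpsi t := by
  unfold dpsi; split_ifs with h1 h2
  · exact le_rfl
  · have : 0 ≤ (t+1)^2 * (1 - 2 * t) := mul_nonneg (sq_nonneg _) (by linarith)
    nlinarith
  · exact zero_le_one

lemma dpsi_le_one (t : ℝ) : dpsi t ≤ 1 := by
  unfold dpsi; split_ifs with h1 h2
  · exact zero_le_one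
  · have : 0 ≤ t^2 * (2 * t + 3) := mul_nonneg (sq_nonneg _) (by linarith)
    nlinarith
  · exact le_rfl

lemma mul_dpsi (t : ℝ) : -(t * dpsi t) ≤ 1 - max t 0 := by
  rcases le_or_gt t (-1) with h | h
  · rw [max_eq_right (by linarith)]; unfold dpsi; rw [if_pos h]; norm_num
  · rcases le_or_gt t 0 with h' | h'
    · rw [max_eq_right h']; nlinarith [dpsi_nonneg t, dpsi_le_one t]
    · rw [max_eq_left h'.le]; unfold dpsi
      rw [if_neg (by linarith), if_neg (by linarith)]; linarith

lemma psi_ge (t : ℝ) : max t (-(1/2)) ≤ psi t := by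
  unfold psi; split_ifs with h1 h2
  · exact max_le (by linarith) le_rfl
  · refine max_le ?_ ?_
    · have : 0 ≤ t^3 * (-2 - t) + 0 ∨ True := Or.inr trivial
      have h3 : 0 ≤ -t := by linarith
      have h4 : 0 ≤ t + 1 := by linarith
      nlinarith [mul_nonneg h3 h4, mul_nonneg (mul_nonneg h3 h4) h3, mul_nonneg (mul_nonneg h3 h4) h4, mul_nonneg (sq_nonneg t) h4, mul_nonneg (mul_nonneg (sq_nonneg t) h3) h4, pow_nonneg h3 3, sq_nonneg t]
    · have : 0 ≤ (t+1)^3 * (1 - t) := mul_nonneg (pow_nonneg (by linarith) _) (by linarith)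
      nlinarith
  · exact max_le le_rfl (by linarith)

lemma psi_le (t : ℝ) : psi t ≤ |t| := by
  unfold psi; split_ifs with h1 h2
  · linarith [abs_nonneg t]
  · rw [abs_of_nonpos h2]
    have h3 : 0 ≤ -t := by linarith
    have h4 : 0 ≤ t + 1 := by linarith
    have : (t+1)^3 * (1 - t) ≤ 1 := by
      have h5 : (t+1)^2 ≤ 1 := by nlinarith
      have h6 : (t+1) * (1-t) ≤ 1 := by nlinarith
      have h7 : (t+1)^3 * (1 - t) = (t+1)^2 * ((t+1)*(1-t)) := by ring
      rw [h7]
      exact mul_le_one₀ h5 (mul_nonneg h4 (by linarith)) h6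
    nlinarith
  · exact le_abs_self t

/-- Base of the Lyapunov function. -/
def WW (m : ℕ) (μ : Fin m → ℝ) (δ : ℝ) (x : Fin m → ℝ) : ℝ :=
  δ * Psi m μ (-x) + Psi m μ x + (m : ℝ) / ⨅ i, μ i

lemma WW_fderiv (m : ℕ) (μ : Fin m → ℝ) (δ : ℝ) (x : Fin m → ℝ) :
    HasFDerivAt (WW m μ δ)
      (δ • (∑ i, (-dpsi (-x i) / μ i) • (ContinuousLinearMap.proj i : (Fin m → ℝ) →L[ℝ] ℝ))
        + ∑ i, (dpsi (x i) / μ i) • (ContinuousLinearMap.proj i : (Fin m → ℝ) →L[ℝ] ℝ)) x := by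
  have hp : ∀ i, HasFDerivAt (fun y : Fin m → ℝ => y i)
      (ContinuousLinearMap.proj i : (Fin m → ℝ) →L[ℝ] ℝ) x := fun i => hasFDerivAt_apply i x
  have h1 : HasFDerivAt (Psi m μ)
      (∑ i, (dpsi (x i) / μ i) • (ContinuousLinearMap.proj i : (Fin m → ℝ) →L[ℝ] ℝ)) x := by
    unfold Psi
    refine HasFDerivAt.fun_sum fun i _ => ?_
    exact ((psi_hasDerivAt (x i)).div_const (μ i)).comp_hasFDerivAt x (hp i)
  have h2 : HasFDerivAt (fun y => Psi m μ (-y))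
      (∑ i, (-dpsi (-x i) / μ i) • (ContinuousLinearMap.proj i : (Fin m → ℝ) →L[ℝ] ℝ)) x := by
    unfold Psi
    refine HasFDerivAt.fun_sum fun i _ => ?_
    have h3 : HasDerivAt (fun t => psi (-t)) (-dpsi (-x i)) (x i) := by
      have := (psi_hasDerivAt (-x i)).comp (x i) (hasDerivAt_neg (x i))
      simpa [Function.comp_def] using this
    exact (h3.div_const (μ i)).comp_hasFDerivAt x (hp i)
  unfold WW
  exact ((h2.const_mul δ).add h1).add_const _

lemma WW_pos (m : ℕ) (hm : 1 ≤ m) (μ : Fin m → ℝ) (hμ : ∀ i, 0 < μ i) (δ : ℝ) (h0 : 0 < δ)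
    (h1 : δ ≤ 1) (x : Fin m → ℝ) : 0 < WW m μ δ x := by
  haveI : Nonempty (Fin m) := ⟨⟨0, hm⟩⟩
  obtain ⟨k, hk⟩ := exists_eq_ciInf_of_finite (f := μ)
  have hle : ∀ i, μ k ≤ μ i := fun i => hk ▸ ciInf_le (Set.finite_range μ).bddBelow i
  have : WW m μ δ x = ∑ i, (δ * (psi (-x i) / μ i) + psi (x i) / μ i + 1 / μ k) := by
    unfold WW Psi
    rw [← hk, Finset.sum_add_distrib, Finset.sum_add_distrib, Finset.mul_sum]
    simp [div_eq_mul_inv]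
  rw [this]
  refine Finset.sum_pos (fun i _ => ?_) Finset.univ_nonempty
  have ha := psi_ge (x i)
  have hb := psi_ge (-x i)
  rw [max_le_iff] at ha hb
  have hs : -(1/2) ≤ δ * psi (-x i) + psi (x i) := by
    rcases le_total 0 (x i) with h | h
    · nlinarith
    · nlinarith
  have h2 : 1 / μ i ≤ 1 / μ k := one_div_le_one_div_of_le (hμ k) (hle i)
  have h3 : 0 < 1 / μ i := one_div_pos.mpr (hμ i)
  have h4 : δ * (psi (-x i) / μ i) + psi (x i) / μ i
      = (δ * psi (-x i) + psi (x i)) * (1 / μ i) := by ring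
  rw [h4]
  nlinarith

lemma WW_le (m : ℕ) (μ : Fin m → ℝ) (hμ : ∀ i, 0 < μ i) (δ : ℝ) (h0 : 0 < δ)
    (h1 : δ ≤ 1) (x : Fin m → ℝ) :
    WW m μ δ x ≤ 2 * (∑ i, 1 / μ i) * (∑ i, |x i|) + (m : ℝ) / ⨅ i, μ i := by
  have hP : ∀ y : Fin m → ℝ, Psi m μ y ≤ (∑ i, 1 / μ i) * ∑ i, |y i| := by
    intro y
    rw [Finset.sum_mul]
    refine Finset.sum_le_sum fun i _ => ?_
    rw [div_eq_mul_one_div, mul_comm]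
    refine mul_le_mul_of_nonneg_left ?_ (one_div_pos.mpr (hμ i)).le
    exact (psi_le _).trans (Finset.single_le_sum (f := fun j => |y j|)
      (fun j _ => abs_nonneg _) (Finset.mem_univ i))
  have ha := hP x
  have hb := hP (-x)
  simp only [Pi.neg_apply, abs_neg] at hb
  have hn : 0 ≤ (∑ i, 1 / μ i) * ∑ i, |x i| :=
    mul_nonneg (Finset.sum_nonneg fun i _ => (one_div_pos.mpr (hμ i)).le)
      (Finset.sum_nonneg fun i _ => abs_nonneg _)
  unfold WW
  have : δ * Psi m μ (-x) ≤ (∑ i, 1 / μ i) * ∑ i, |x i| := by nlinarith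
  linarith

/-- The final Young-type step. -/
lemma young_step (p C c W : ℝ) (hp : 1 < p) (hC : 0 < C) (hc : 0 < c) (hW : 0 < W) :
    p * W ^ (p - 1) * (C - c * W) ≤
      (p * (2 * C / c) ^ (p - 1) * C + p * c / 2 * (2 * C / c) ^ p) - p * c / 2 * W ^ p := by
  have hT : 0 < 2 * C / c := by positivity
  have hWp : W ^ p = W ^ (p - 1) * W := by
    rw [← Real.rpow_add_one hW.ne']; congr 1; ring
  have hA : 0 < W ^ (p - 1) := Real.rpow_pos_of_pos hW _
  have hp0 : 0 < p := by linarith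
  rcases le_total W (2 * C / c) with h | h
  · have h1 : W ^ (p - 1) ≤ (2 * C / c) ^ (p - 1) :=
      Real.rpow_le_rpow hW.le h (by linarith)
    have h2 : W ^ p ≤ (2 * C / c) ^ p := Real.rpow_le_rpow hW.le h (by linarith)
    have h3 : p * W ^ (p - 1) * (C - c * W) ≤ p * W ^ (p - 1) * C :=
      mul_le_mul_of_nonneg_left (by nlinarith) (by positivity)
    have h4 : p * W ^ (p - 1) * C ≤ p * (2 * C / c) ^ (p - 1) * C := by gcongr
    have h5 : p * c / 2 * W ^ p ≤ p * c / 2 * (2 * C / c) ^ p := by gcongr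
    linarith
  · have h1 : 2 * C ≤ W * c := (div_le_iff₀ hc).mp h
    have h2 : 0 ≤ p * (2 * C / c) ^ (p - 1) * C + p * c / 2 * (2 * C / c) ^ p := by positivity
    have h3 : p * W ^ (p - 1) * (C - c * W) ≤ p * W ^ (p - 1) * (-(c * W / 2)) :=
      mul_le_mul_of_nonneg_left (by linarith) (by positivity)
    have h4 : p * W ^ (p - 1) * (-(c * W / 2)) = - (p * c / 2 * W ^ p) := by rw [hWp]; ring
    linarith

/-- Estimate of the drift of the base function. -/
lemma drift_est (m : ℕ) (μ γ : Fin m → ℝ) (hμ : ∀ i, 0 < μ i)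
    (β δ ε : ℝ) (h0 : 0 < δ) (h1 : δ ≤ 1) (hε : 0 < ε) (hε1 : ε ≤ 1 / 2)
    (hr : ∀ i, ε ≤ γ i / μ i) (hR : ∀ i, δ * (γ i / μ i) ≤ 1 / 2)
    (x u : Fin m → ℝ) (hu : ∀ i, 0 ≤ u i) (hs : ∑ i, u i = 1) :
    (δ • (∑ i, (-dpsi (-x i) / μ i) • (ContinuousLinearMap.proj i : (Fin m → ℝ) →L[ℝ] ℝ))
        + ∑ i, (dpsi (x i) / μ i) • (ContinuousLinearMap.proj i : (Fin m → ℝ) →L[ℝ] ℝ))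
      (drift m μ γ β x u) ≤ m * (|β / m| + 2) - min ε δ * ∑ i, |x i| := by
  have e1 : (δ • (∑ i, (-dpsi (-x i) / μ i) • (ContinuousLinearMap.proj i : (Fin m → ℝ) →L[ℝ] ℝ))
        + ∑ i, (dpsi (x i) / μ i) • (ContinuousLinearMap.proj i : (Fin m → ℝ) →L[ℝ] ℝ))
      (drift m μ γ β x u) = ∑ i, (dpsi (x i) - δ * dpsi (-x i)) *
        (-(β / m) - x i + max (∑ j, x j) 0 * u i * (1 - γ i / μ i)) := by
    simp only [ContinuousLinearMap.add_apply, ContinuousLinearMap.smul_apply,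
      ContinuousLinearMap.sum_apply, ContinuousLinearMap.proj_apply, smul_eq_mul, drift]
    rw [Finset.mul_sum, ← Finset.sum_add_distrib]
    refine Finset.sum_congr rfl fun i _ => ?_
    have := (hμ i).ne'
    field_simp
    ring
  rw [e1]
  set S := max (∑ j, x j) 0 with hS
  have hS0 : 0 ≤ S := le_max_right _ _
  have hS1 : S ≤ ∑ i, max (x i) 0 :=
    max_le (Finset.sum_le_sum fun i _ => le_max_left _ _)
      (Finset.sum_nonneg fun i _ => le_max_right _ _)
  have hterm : ∀ i, (dpsi (x i) - δ * dpsi (-x i)) *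
        (-(β / m) - x i + S * u i * (1 - γ i / μ i)) ≤
        (|β / m| + 2) - max (x i) 0 - δ * max (-x i) 0 + S * (1 - ε) * u i := by
    intro i
    have a0 := dpsi_nonneg (x i)
    have a1 := dpsi_le_one (x i)
    have b0 := dpsi_nonneg (-x i)
    have b1 := dpsi_le_one (-x i)
    have ha := mul_dpsi (x i)
    have hb := mul_dpsi (-x i)
    set a := dpsi (x i)
    set b := dpsi (-x i)
    have hd : |a - δ * b| ≤ 1 := by
      rw [abs_le]; constructor <;> nlinarith
    have t1 : (a - δ * b) * (-(β / m)) ≤ |β / m| := by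
      calc _ ≤ |(a - δ * b) * (-(β / m))| := le_abs_self _
        _ = |a - δ * b| * |β / m| := by rw [abs_mul, abs_neg]
        _ ≤ 1 * |β / m| := by gcongr
        _ = _ := one_mul _
    have t2 : δ * (-(-x i * b)) ≤ δ * (1 - max (-x i) 0) := mul_le_mul_of_nonneg_left hb h0.le
    have t3 : (a - δ * b) * (1 - γ i / μ i) ≤ 1 - ε := by
      have hri := hr i
      have hRi := hR i
      set r := γ i / μ i
      have hdb : 0 ≤ δ * b := mul_nonneg h0.le b0
      have hdb1 : δ * b ≤ δ := by nlinarith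
      rcases le_total r 1 with h | h
      · nlinarith
      · nlinarith
    have t4 : S * u i * ((a - δ * b) * (1 - γ i / μ i)) ≤ S * u i * (1 - ε) :=
      mul_le_mul_of_nonneg_left t3 (mul_nonneg hS0 (hu i))
    nlinarith
  refine (Finset.sum_le_sum fun i _ => hterm i).trans ?_
  rw [Finset.sum_add_distrib, ← Finset.mul_sum, hs, Finset.sum_sub_distrib,
    Finset.sum_sub_distrib, ← Finset.mul_sum]
  simp only [Finset.sum_const, Finset.card_univ, Fintype.card_fin, nsmul_eq_mul]
  have habs : ∑ i, |x i| = ∑ i, max (x i) 0 + ∑ i, max (-x i) 0 := by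
    rw [← Finset.sum_add_distrib]
    refine Finset.sum_congr rfl fun i _ => ?_
    rcases le_total 0 (x i) with h | h
    · rw [abs_of_nonneg h, max_eq_left h, max_eq_right (by linarith)]; ring
    · rw [abs_of_nonpos h, max_eq_right h, max_eq_left (by linarith)]; ring
  rw [habs]
  have hP : 0 ≤ ∑ i, max (x i) 0 := Finset.sum_nonneg fun i _ => le_max_right _ _
  have hN : 0 ≤ ∑ i, max (-x i) 0 := Finset.sum_nonneg fun i _ => le_max_right _ _
  have k1 : min ε δ * ∑ i, max (x i) 0 ≤ ε * ∑ i, max (x i) 0 :=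
    mul_le_mul_of_nonneg_right (min_le_left _ _) hP
  have k2 : min ε δ * ∑ i, max (-x i) 0 ≤ δ * ∑ i, max (-x i) 0 :=
    mul_le_mul_of_nonneg_right (min_le_right _ _) hN
  have k3 : S * (1 - ε) ≤ (∑ i, max (x i) 0) * (1 - ε) :=
    mul_le_mul_of_nonneg_right hS1 (by linarith)
  nlinarith

/-- Lemma 2: if `γ_i > 0` for all `i`, then for every `p > 1` there exist
`δ ∈ (0,1]` and positive constants `c₀, c₁` such that
`⟨b(x,u), ∇V_p(x)⟩ ≤ c₀ - c₁ V_p(x)` for all `x ∈ ℝ^m` and all `u ∈ Δ`. -/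
theorem stmt_7 (m : ℕ) (hm : 1 ≤ m) (μ γ : Fin m → ℝ)
    (hμ : ∀ i, 0 < μ i) (hγ : ∀ i, 0 < γ i)
    (β : ℝ) (p : ℝ) (hp : 1 < p) :
    ∃ δ : ℝ, 0 < δ ∧ δ ≤ 1 ∧ ∃ c₀ c₁ : ℝ, 0 < c₀ ∧ 0 < c₁ ∧
      ∀ x u : Fin m → ℝ, (∀ i, 0 ≤ u i) → ∑ i, u i = 1 →
        fderiv ℝ (Vp m μ δ p) x (drift m μ γ β x u) ≤ c₀ - c₁ * Vp m μ δ p x := by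
  haveI : Nonempty (Fin m) := ⟨⟨0, hm⟩⟩
  have hrpos : ∀ i, 0 < γ i / μ i := fun i => div_pos (hγ i) (hμ i)
  obtain ⟨k, hk⟩ := Finite.exists_min (fun i => γ i / μ i)
  obtain ⟨l, hl⟩ := Finite.exists_max (fun i => γ i / μ i)
  have hRpos := hrpos l
  set R := γ l / μ l with hRdef
  set δ := 1 / (2 * (R + 1)) with hδ
  set ε := min (γ k / μ k) (1 / 2) with hε
  have hδ0 : 0 < δ := by positivity
  have hδ2 : δ * (2 * (R + 1)) = 1 := by rw [hδ]; field_simp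
  have hδ1 : δ ≤ 1 := by nlinarith
  have hε0 : 0 < ε := lt_min (hrpos k) (by norm_num)
  have hrε : ∀ i, ε ≤ γ i / μ i := fun i => (min_le_left _ _).trans (hk i)
  have hRδ : ∀ i, δ * (γ i / μ i) ≤ 1 / 2 := fun i => by
    have : δ * (γ i / μ i) ≤ δ * R := mul_le_mul_of_nonneg_left (hl i) hδ0.le
    linarith
  set L := ∑ i, 1 / μ i with hL
  have hL0 : 0 < L := Finset.sum_pos (fun i _ => one_div_pos.mpr (hμ i)) Finset.univ_nonempty
  set K := (m : ℝ) / ⨅ i, μ i with hK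
  have hK0 : 0 ≤ K := div_nonneg (Nat.cast_nonneg _) (Real.iInf_nonneg fun i => (hμ i).le)
  set c := min ε δ with hc
  have hc0 : 0 < c := lt_min hε0 hδ0
  set c' := c / (2 * L) with hc'
  have hc'0 : 0 < c' := by positivity
  have hm0 : (0 : ℝ) < m := by exact_mod_cast hm
  set C := m * (|β / m| + 2) + c' * K with hC
  have hC0 : 0 < C := by positivity
  have hp0 : 0 < p := by linarith
  refine ⟨δ, hδ0, hδ1, p * (2 * C / c') ^ (p - 1) * C + p * c' / 2 * (2 * C / c') ^ p,
    p * c' / 2, by positivity, by positivity, ?_⟩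
  intro x u hu hs
  have hW := WW_pos m hm μ hμ δ hδ0 hδ1 x
  have hWl := WW_le m μ hμ δ hδ0 hδ1 x
  have hD := (WW_fderiv m μ δ x).rpow_const (p := p) (Or.inl hW.ne')
  have hV : Vp m μ δ p = fun y => WW m μ δ y ^ p := rfl
  rw [hV, hD.fderiv, ContinuousLinearMap.smul_apply, smul_eq_mul]
  refine le_trans ?_ (young_step p C c' _ hp hC0 hc'0 hW)
  refine mul_le_mul_of_nonneg_left ?_ (mul_nonneg hp0.le (Real.rpow_nonneg hW.le _))
  refine (drift_est m μ γ hμ β δ ε hδ0 hδ1 hε0 (min_le_right _ _) hrε hRδ x u hu hs).trans ?_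
  have h1 : c' * WW m μ δ x ≤ c' * (2 * L * (∑ i, |x i|) + K) :=
    mul_le_mul_of_nonneg_left hWl hc'0.le
  have h2 : c' * (2 * L) = c := by rw [hc']; field_simp
  have h3 : c' * (2 * L * (∑ i, |x i|) + K) = c * (∑ i, |x i|) + c' * K := by
    rw [← h2]; ring
  linarith

end
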